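/- arXiv:2604.26730 — 4 statements merged into one kernel-verified Lean document; each statement's English description precedes it below -/
import Mathlib

section
/- Let G be a group equipped with a T0 Alexandroff topology making G a paratopological group (multiplication continuous). If G is compact and connected as a topological space, then G has at most one point (G is a subsingleton). -/
/-- A nonempty compact T0 space has a closed point, so one that is homogeneous under left
translations of a group structure is T1. -/
theorem t1Space_of_compactSpace_of_t0Space_of_continuousMul
    (G : Type*) [Group G] [TopologicalSpace G] [T0Space G] [ContinuousMul G] [CompactSpace G] :
    T1Space G := by
  obtain ⟨x, -, hx⟩ := (isClosed_univ (X := G)).exists_closed_singleton Set.univ_nonempty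
  refine ⟨fun y => ?_⟩
  have h : (fun z => x * y⁻¹ * z) ⁻¹' {x} = {y} := by
    ext z
    simp [mul_assoc, inv_mul_eq_one, eq_comm]
  exact h ▸ hx.preimage (continuous_const_mul (x * y⁻¹))

/-- An Alexandroff T1 space is discrete. -/
theorem discreteTopology_of_alexandrovDiscrete_of_t1Space
    (X : Type*) [TopologicalSpace X] [AlexandrovDiscrete X] [T1Space X] :
    DiscreteTopology X := by
  refine discreteTopology_iff_forall_isOpen.2 fun s => ?_
  refine isOpen_iff_forall_specializes.2 fun x y hxy hy => ?_
  rwa [hxy.eq]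

/-- A compact connected Alexandroff paratopological group has at most one point. -/
theorem alexandroff_paratopological_group_compact_connected_subsingleton
    (G : Type*) [Group G] [TopologicalSpace G] [AlexandrovDiscrete G] [T0Space G]
    [ContinuousMul G] [CompactSpace G] [ConnectedSpace G] :
    Subsingleton G := by
  have := t1Space_of_compactSpace_of_t0Space_of_continuousMul G
  have := discreteTopology_of_alexandrovDiscrete_of_t1Space G
  exact PreconnectedSpace.trivial_of_discrete
end

section
/- Let G be a non-compact group equipped with a T0 Alexandroff topology making G a paratopological group (multiplication continuous). If U ⊆ G is an open set, then the set of inverses U⁻¹ = {u⁻¹ : u ∈ U} is a closed set in G. -/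
theorem Specializes.inv_inv {G : Type*} [Group G] [TopologicalSpace G] [ContinuousMul G]
    {x y : G} (h : x ⤳ y) : y⁻¹ ⤳ x⁻¹ := by
  simpa using h.map (f := fun z ↦ x⁻¹ * z * y⁻¹) (by fun_prop)

/-- In a non-compact Alexandroff paratopological group, the set of inverses of an open set
is closed. -/
theorem isClosed_inv_of_isOpen
    (G : Type*) [Group G] [TopologicalSpace G] [AlexandrovDiscrete G] [T0Space G]
    [ContinuousMul G] [NoncompactSpace G] (U : Set G) (hU : IsOpen U) :
    IsClosed U⁻¹ := by
  rw [← isOpen_compl_iff, isOpen_iff_forall_specializes]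
  exact fun x y hxy hy hx ↦ hy (hxy.inv_inv.mem_open hU hx)
end

section
/- Let G be a connected, non-compact group equipped with a T0 Alexandroff topology making G a paratopological group (multiplication continuous). Then G is feebly compact: every locally finite family of nonempty open sets of G is finite. Precisely, if S is a set of open nonempty subsets of G such that every point of G has a neighborhood meeting only finitely many members of S, then S is finite. -/
/-- The elements that can be moved into the least neighbourhood of `1` by right multiplication
by a member of that neighbourhood. -/
def fractionSubgroup (G : Type*) [Group G] [TopologicalSpace G] [ContinuousMul G] :
    Subgroup G where
  carrier := {g | ∃ b : G, b ⤳ 1 ∧ (g * b) ⤳ 1}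
  one_mem' := ⟨1, specializes_rfl, by simp [specializes_rfl]⟩
  mul_mem' := by
    rintro g h ⟨b, hb, hgb⟩ ⟨c, hc, hhc⟩
    refine ⟨c * b, by simpa using hc.mul hb, ?_⟩
    have hconj : (b⁻¹ * (h * c) * b) ⤳ 1 := by
      simpa using ((specializes_refl b⁻¹).mul hhc).mul (specializes_refl b)
    simpa [mul_assoc] using hgb.mul hconj
  inv_mem' := by
    rintro g ⟨b, hb, hgb⟩
    exact ⟨g * b, hgb, by simpa using hb⟩

theorem fractionSubgroup_eq_top (G : Type*) [Group G] [TopologicalSpace G]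
    [AlexandrovDiscrete G] [ContinuousMul G] [ConnectedSpace G] : fractionSubgroup G = ⊤ := by
  have hnhds : (fractionSubgroup G : Set G) ∈ nhds 1 := by
    refine Filter.mem_of_superset (isOpen_nhdsKer.mem_nhds (subset_nhdsKer rfl) :
      nhdsKer {(1 : G)} ∈ nhds 1) fun x hx => ?_
    exact ⟨1, specializes_rfl, by simpa using hx⟩
  have hopen := (fractionSubgroup G).isOpen_of_mem_nhds hnhds
  rw [← SetLike.coe_set_eq, Subgroup.coe_top]
  exact IsClopen.eq_univ ⟨(fractionSubgroup G).isClosed_of_isOpen hopen, hopen⟩ ⟨1, one_mem _⟩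

/-- In a connected Alexandroff paratopological group, any two nonempty open sets meet. -/
theorem IsOpen.inter_nonempty_of_alexandrovDiscrete_group {G : Type*} [Group G]
    [TopologicalSpace G] [AlexandrovDiscrete G] [ContinuousMul G] [ConnectedSpace G]
    {U V : Set G} (hU : IsOpen U) (hV : IsOpen V) (hU' : U.Nonempty) (hV' : V.Nonempty) :
    (U ∩ V).Nonempty := by
  obtain ⟨x, hx⟩ := hU'
  obtain ⟨y, hy⟩ := hV'
  obtain ⟨b, hb, hab⟩ : y⁻¹ * x ∈ fractionSubgroup G := by simp [fractionSubgroup_eq_top]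
  refine ⟨x * b, Specializes.mem_open ?_ hU hx, Specializes.mem_open ?_ hV hy⟩
  · simpa using (specializes_refl x).mul hb
  · simpa [mul_assoc] using (specializes_refl y).mul hab

/-- A connected non-compact Alexandroff paratopological group is feebly compact: every
locally finite family of nonempty open sets is finite. -/
theorem alexandroff_paratopological_group_feebly_compact
    (G : Type*) [Group G] [TopologicalSpace G] [AlexandrovDiscrete G] [T0Space G]
    [ContinuousMul G] [ConnectedSpace G] [NoncompactSpace G]
    (S : Set (Set G)) (hopen : ∀ U ∈ S, IsOpen U) (hne : ∀ U ∈ S, U.Nonempty)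
    (hlf : ∀ x : G, ∃ t ∈ nhds x, {U ∈ S | (U ∩ t).Nonempty}.Finite) :
    S.Finite := by
  obtain ⟨t, ht, hfin⟩ := hlf 1
  refine hfin.subset fun U hU => ⟨hU, ?_⟩
  exact ((hopen U hU).inter_nonempty_of_alexandrovDiscrete_group isOpen_interior (hne U hU)
    ⟨1, mem_interior_iff_mem_nhds.mpr ht⟩).mono (Set.inter_subset_inter_right U interior_subset)
end

section
/- Let G be a connected, non-compact group equipped with a T0 Alexandroff topology making G a paratopological group (multiplication continuous). Then G is hyperconnected: any two nonempty open subsets of G have nonempty intersection (G is an irreducible topological space). -/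
/-- In a paratopological group, two generizations of a point have a common generization. -/
theorem exists_specializes_of_specializes {G : Type*} [Group G] [TopologicalSpace G]
    [ContinuousMul G] {x y z : G} (hx : x ⤳ z) (hy : y ⤳ z) : ∃ w : G, w ⤳ x ∧ w ⤳ y := by
  refine ⟨x * z⁻¹ * y, ?_, ?_⟩
  · simpa using (specializes_refl (x * z⁻¹)).mul hy
  · simpa [mul_assoc] using hx.mul (specializes_refl (z⁻¹ * y))

/-- In a connected Alexandroff paratopological group, any two points have a common generization. -/
theorem exists_common_generization {G : Type*} [Group G] [TopologicalSpace G]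
    [AlexandrovDiscrete G] [ContinuousMul G] [PreconnectedSpace G] (x y : G) :
    ∃ z : G, z ⤳ x ∧ z ⤳ y := by
  refine PreconnectedSpace.induction₂' (fun x y : G => ∃ z : G, z ⤳ x ∧ z ⤳ y) (fun x => ?_)
    ⟨?_⟩ x y
  · filter_upwards [nhdsKer_singleton_subset_iff_mem_nhds.1 (subset_refl (nhdsKer {x}))] with y hy
    have hyx := mem_nhdsKer_singleton.1 hy
    exact ⟨⟨y, hyx, specializes_rfl⟩, ⟨y, specializes_rfl, hyx⟩⟩
  · rintro a b c ⟨z, hza, hzb⟩ ⟨w, hwb, hwc⟩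
    obtain ⟨u, huz, huw⟩ := exists_specializes_of_specializes hzb hwb
    exact ⟨u, huz.trans hza, huw.trans hwc⟩

/-- Every connected non-compact Alexandroff paratopological group is hyperconnected
(irreducible as a topological space): any two nonempty open sets intersect. -/
theorem alexandroff_paratopological_group_hyperconnected
    (G : Type*) [Group G] [TopologicalSpace G] [AlexandrovDiscrete G] [T0Space G]
    [ContinuousMul G] [ConnectedSpace G] [NoncompactSpace G] :
    IrreducibleSpace G := by
  refine { isPreirreducible_univ := ?_, toNonempty := inferInstance }
  rintro U V hU hV ⟨x, -, hx⟩ ⟨y, -, hy⟩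
  obtain ⟨z, hzx, hzy⟩ := exists_common_generization x y
  exact ⟨z, Set.mem_univ z, hzx.mem_open hU hx, hzy.mem_open hV hy⟩
end
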